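/- arXiv:2203.11340 — 4 statements merged into one kernel-verified Lean document; each statement's English description precedes it below -/
import Mathlib

section
/- Let g > 0, H > 0 and let ω : ℝ → ℝ be the smooth odd function ω(ξ) = sgn(ξ)·√(g|ξ| tanh(H|ξ|)) (equivalently ω(ξ) = ξ·√(g·f(ξ)) where f(ξ) = tanh(Hξ)/ξ is extended by f(0) = H, making f smooth, even and positive). Let A : ℝ → ℂ be a Schwartz function, and let c ∈ ℝ with |c| > √(gH). Then the oscillatory integral I(t) = ∫_ℝ exp(i(cξ − ω(ξ))t) A(ξ) dξ decays rapidly: for every n ∈ ℕ there exists C > 0 such that |I(t)| ≤ C t^{−n} for all t ≥ 1. -/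
open MeasureTheory Filter Topology

namespace WaterWaves

open scoped ContDiff

/-! ### Hyperbolic tangent -/

theorem hasDerivAt_tanh (x : ℝ) : HasDerivAt Real.tanh (1 - Real.tanh x ^ 2) x := by
  have hc := (Real.cosh_pos x).ne'
  have h := (Real.hasDerivAt_sinh x).div (Real.hasDerivAt_cosh x) hc
  have e : Real.sinh / Real.cosh = Real.tanh := by
    funext y; simp [Real.tanh_eq_sinh_div_cosh]
  rw [e] at h
  refine h.congr_deriv ?_
  rw [Real.tanh_eq_sinh_div_cosh]
  field_simp

theorem strictMono_tanh : StrictMono Real.tanh :=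
  strictMono_of_hasDerivAt_pos hasDerivAt_tanh fun x ↦ by linarith [Real.tanh_sq_lt_one x]

theorem tanh_pos {x : ℝ} (hx : 0 < x) : 0 < Real.tanh x := by
  simpa using strictMono_tanh hx

theorem tanh_le_self {x : ℝ} (hx : 0 ≤ x) : Real.tanh x ≤ x := by
  have hd : ∀ y, HasDerivAt (fun y ↦ y - Real.tanh y) (Real.tanh y ^ 2) y := fun y ↦ by
    exact ((hasDerivAt_id y).sub (hasDerivAt_tanh y)).congr_deriv (by ring)
  have hm : Monotone fun y ↦ y - Real.tanh y :=
    monotone_of_deriv_nonneg (fun y ↦ (hd y).differentiableAt) fun y ↦ by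
      rw [(hd y).deriv]; positivity
  simpa using hm hx

theorem mul_one_sub_tanh_sq_le {x : ℝ} (hx : 0 ≤ x) :
    x * (1 - Real.tanh x ^ 2) ≤ Real.tanh x := by
  have hc := Real.cosh_pos x
  have h1 := Real.self_le_sinh_iff.2 hx
  have h2 := Real.one_le_cosh x
  have e : 1 - Real.tanh x ^ 2 = 1 / Real.cosh x ^ 2 := by
    rw [Real.tanh_eq_sinh_div_cosh]
    field_simp
    linarith [Real.cosh_sq x]
  rw [e, Real.tanh_eq_sinh_div_cosh, mul_one_div, div_le_div_iff₀ (by positivity) hc]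
  nlinarith [mul_nonneg (hx.trans h1) (sub_nonneg.2 h2)]

theorem tanh_add_mul_sq_le (x : ℝ) :
    (Real.tanh x + x * (1 - Real.tanh x ^ 2)) ^ 2 ≤ 4 * (x * Real.tanh x) := by
  wlog hx : 0 ≤ x generalizing x
  · have h := this (-x) (by linarith)
    rw [Real.tanh_neg] at h
    nlinarith [h]
  have hT : 0 ≤ Real.tanh x := by simpa using strictMono_tanh.monotone hx
  have h1 := tanh_le_self hx
  have h2 := mul_one_sub_tanh_sq_le hx
  have h3 : 0 ≤ x * (1 - Real.tanh x ^ 2) :=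
    mul_nonneg hx (by linarith [Real.tanh_sq_lt_one x])
  nlinarith

theorem analyticAt_dslope_tanh (x : ℝ) : AnalyticAt ℝ (dslope Real.tanh 0) x := by
  have ht : ∀ y, AnalyticAt ℝ Real.tanh y := fun y ↦ by
    have e : Real.tanh = fun z ↦ Real.sinh z / Real.cosh z := by
      funext z; exact Real.tanh_eq_sinh_div_cosh z
    rw [e]
    exact (Real.analyticAt_sinh).div (Real.analyticAt_cosh) (Real.cosh_pos y).ne'
  by_cases hx : x = 0
  · subst hx
    obtain ⟨p, hp⟩ := ht 0
    exact hp.has_fpower_series_dslope_fslope.analyticAt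
  · have : AnalyticAt ℝ (fun y ↦ Real.tanh y / y) x := (ht x).div analyticAt_id hx
    refine this.congr ?_
    filter_upwards [dslope_eventuallyEq_slope_of_ne Real.tanh hx] with y hy
    rw [hy]
    simp [slope_def_field]

theorem dslope_tanh_of_ne {x : ℝ} (hx : x ≠ 0) : dslope Real.tanh 0 x = Real.tanh x / x := by
  simp [dslope_of_ne _ hx, slope_def_field]

theorem dslope_tanh_pos (x : ℝ) : 0 < dslope Real.tanh 0 x := by
  rcases lt_trichotomy x 0 with hx | rfl | hx
  · rw [dslope_tanh_of_ne hx.ne]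
    exact div_pos_of_neg_of_neg (by simpa using strictMono_tanh hx) hx
  · simp [dslope_same, (hasDerivAt_tanh 0).deriv]
  · rw [dslope_tanh_of_ne hx.ne']
    exact div_pos (tanh_pos hx) hx

/-! ### Polynomial growth of derivatives on a set -/

/-- `f` is polynomially bounded on `s`. -/
def PolyBoundedOn (s : Set ℝ) (f : ℝ → ℝ) : Prop :=
  ∃ (k : ℕ) (C : ℝ), ∀ x ∈ s, |f x| ≤ C * (1 + |x|) ^ k

/-- The derivatives of `f` of order at most `n` exist and are polynomially bounded on `s`. -/
inductive GrowthOn (s : Set ℝ) : ℕ → (ℝ → ℝ) → Prop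
  | zero {f : ℝ → ℝ} (h0 : PolyBoundedOn s f) : GrowthOn s 0 f
  | succ {n : ℕ} {f f' : ℝ → ℝ} (h0 : PolyBoundedOn s f)
      (hd : ∀ x ∈ s, HasDerivAt f (f' x) x) (h' : GrowthOn s n f') : GrowthOn s (n + 1) f

namespace PolyBoundedOn

variable {s : Set ℝ} {f h : ℝ → ℝ}

theorem of_bounded (C : ℝ) (hf : ∀ x ∈ s, |f x| ≤ C) : PolyBoundedOn s f :=
  ⟨0, C, by simpa using hf⟩

theorem add (hf : PolyBoundedOn s f) (hh : PolyBoundedOn s h) :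
    PolyBoundedOn s fun x ↦ f x + h x := by
  obtain ⟨k, C, hC⟩ := hf
  obtain ⟨l, D, hD⟩ := hh
  refine ⟨k + l, |C| + |D|, fun x hx ↦ (abs_add_le _ _).trans ?_⟩
  have hb : (1 : ℝ) ≤ 1 + |x| := by linarith [abs_nonneg x]
  have h1 : |f x| ≤ |C| * (1 + |x|) ^ (k + l) :=
    (hC x hx).trans (mul_le_mul (le_abs_self C) (pow_le_pow_right₀ hb (by lia))
      (by positivity) (by positivity))
  have h2 : |h x| ≤ |D| * (1 + |x|) ^ (k + l) :=
    (hD x hx).trans (mul_le_mul (le_abs_self D) (pow_le_pow_right₀ hb (by lia))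
      (by positivity) (by positivity))
  linarith

theorem mul (hf : PolyBoundedOn s f) (hh : PolyBoundedOn s h) :
    PolyBoundedOn s fun x ↦ f x * h x := by
  obtain ⟨k, C, hC⟩ := hf
  obtain ⟨l, D, hD⟩ := hh
  refine ⟨k + l, C * D, fun x hx ↦ ?_⟩
  rw [abs_mul, pow_add, mul_mul_mul_comm]
  exact mul_le_mul (hC x hx) (hD x hx) (abs_nonneg _) ((abs_nonneg _).trans (hC x hx))

end PolyBoundedOn

namespace GrowthOn

variable {s : Set ℝ} {f h : ℝ → ℝ} {n : ℕ}

theorem polyBoundedOn (hf : GrowthOn s n f) : PolyBoundedOn s f := by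
  cases hf <;> assumption

theorem pred (hf : GrowthOn s (n + 1) f) : GrowthOn s n f := by
  induction n generalizing f with
  | zero => exact zero hf.polyBoundedOn
  | succ n ih =>
    cases hf with
    | succ h0 hd h' => exact succ h0 hd (ih h')

theorem const (c : ℝ) : GrowthOn s n fun _ ↦ c := by
  have h0 (c : ℝ) : PolyBoundedOn s fun _ ↦ c := .of_bounded |c| fun _ _ ↦ le_rfl
  induction n generalizing c with
  | zero => exact zero (h0 c)
  | succ n ih => exact succ (h0 c) (fun x _ ↦ hasDerivAt_const x c) (ih 0)

theorem id : GrowthOn s n fun x ↦ x := by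
  have h0 : PolyBoundedOn s fun x ↦ x := ⟨1, 1, fun x _ ↦ by simp⟩
  cases n with
  | zero => exact zero h0
  | succ n => exact succ h0 (fun x _ ↦ hasDerivAt_id x) (const 1)

theorem add (hf : GrowthOn s n f) (hh : GrowthOn s n h) : GrowthOn s n fun x ↦ f x + h x := by
  have h0 := hf.polyBoundedOn.add hh.polyBoundedOn
  induction n generalizing f h with
  | zero => exact zero h0
  | succ n ih =>
    cases hf with
    | succ _ hfd hf' =>
      cases hh with
      | succ _ hhd hh' =>
        exact succ h0 (fun x hx ↦ (hfd x hx).add (hhd x hx))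
          (ih hf' hh' (hf'.polyBoundedOn.add hh'.polyBoundedOn))

theorem mul (hf : GrowthOn s n f) (hh : GrowthOn s n h) : GrowthOn s n fun x ↦ f x * h x := by
  induction n generalizing f h with
  | zero => exact zero (hf.polyBoundedOn.mul hh.polyBoundedOn)
  | succ n ih =>
    have h0 := hf.polyBoundedOn.mul hh.polyBoundedOn
    have hfn := hf.pred
    have hhn := hh.pred
    cases hf with
    | succ _ hfd hf' =>
      cases hh with
      | succ _ hhd hh' =>
        exact succ h0 (fun x hx ↦ (hfd x hx).mul (hhd x hx)) ((ih hf' hhn).add (ih hfn hh'))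

theorem inv {δ : ℝ} (hδ : 0 < δ) (hb : ∀ x ∈ s, δ ≤ |f x|) (hf : GrowthOn s n f) :
    GrowthOn s n fun x ↦ (f x)⁻¹ := by
  have h0 : PolyBoundedOn s fun x ↦ (f x)⁻¹ := .of_bounded δ⁻¹ fun x hx ↦ by
    rw [abs_inv]; exact inv_anti₀ hδ (hb x hx)
  induction n with
  | zero => exact zero h0
  | succ n ih =>
    have hi := ih hf.pred
    cases hf with
    | succ _ hfd hf' =>
      refine succ h0 (fun x hx ↦ ?_) ((const (-1)).mul (hf'.mul (hi.mul hi)))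
      have hne : f x ≠ 0 := abs_pos.1 (hδ.trans_le (hb x hx))
      exact ((hfd x hx).fun_inv hne).congr_deriv (by field_simp)

theorem congr (hs : IsOpen s) (hf : GrowthOn s n f) (he : Set.EqOn h f s) : GrowthOn s n h := by
  have h0 : PolyBoundedOn s h := by
    obtain ⟨k, C, hC⟩ := hf.polyBoundedOn
    exact ⟨k, C, fun x hx ↦ by simpa [he hx] using hC x hx⟩
  cases hf with
  | zero => exact zero h0
  | succ _ hd h' =>
    exact succ h0 (fun x hx ↦ (hd x hx).congr_of_eventuallyEq
      (he.eventuallyEq_of_mem (hs.mem_nhds hx))) h'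

theorem deriv (hs : IsOpen s) (hf : GrowthOn s (n + 1) f) : GrowthOn s n (deriv f) := by
  cases hf with
  | succ _ hd h' => exact h'.congr hs fun x hx ↦ (hd x hx).deriv

theorem polyBoundedOn_iteratedDeriv (hs : IsOpen s) (hf : GrowthOn s n f) :
    PolyBoundedOn s (iteratedDeriv n f) := by
  induction n generalizing f with
  | zero => simpa using hf.polyBoundedOn
  | succ n ih =>
    rw [iteratedDeriv_succ']
    exact ih (hf.deriv hs)

end GrowthOn

theorem hasTemperateGrowth_of_growthOn {f : ℝ → ℝ} (hf : ContDiff ℝ ∞ f) (R : ℝ)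
    (hg : ∀ n, GrowthOn {x | R < |x|} n f) : f.HasTemperateGrowth := by
  refine ⟨hf, fun n ↦ ?_⟩
  obtain ⟨k, C, hC⟩ := (hg n).polyBoundedOn_iteratedDeriv (isOpen_lt continuous_const continuous_abs)
  obtain ⟨D, hD⟩ := (isCompact_Icc (a := -R) (b := R)).exists_bound_of_continuousOn
    (hf.continuous_iteratedDeriv n (by exact_mod_cast le_top)).continuousOn
  refine ⟨k, |C| + |D|, fun x ↦ ?_⟩
  rw [norm_iteratedFDeriv_eq_norm_iteratedDeriv, Real.norm_eq_abs x]
  have hb : (1 : ℝ) ≤ (1 + |x|) ^ k := one_le_pow₀ (by linarith [abs_nonneg x])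
  rcases lt_or_ge R |x| with hx | hx
  · calc ‖iteratedDeriv n f x‖ ≤ C * (1 + |x|) ^ k := hC x hx
      _ ≤ (|C| + |D|) * (1 + |x|) ^ k := by
        gcongr; linarith [le_abs_self C, abs_nonneg D]
  · calc ‖iteratedDeriv n f x‖ ≤ D := hD x (abs_le.1 hx)
      _ ≤ |C| + |D| := by linarith [le_abs_self D, abs_nonneg C]
      _ ≤ (|C| + |D|) * (1 + |x|) ^ k := le_mul_of_one_le_right (by positivity) hb

/-! ### Non-stationary phase -/

theorem norm_oscillation (a : ℝ) (z : ℂ) : ‖Complex.exp (Complex.I * (a : ℂ)) * z‖ = ‖z‖ := by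
  rw [norm_mul, mul_comm Complex.I, Complex.norm_exp_ofReal_mul_I, one_mul]

theorem integrable_oscillation {φ : ℝ → ℝ} (hφ : Continuous φ) (A : SchwartzMap ℝ ℂ) (t : ℝ) :
    Integrable fun ξ ↦ Complex.exp (Complex.I * ((φ ξ * t : ℝ) : ℂ)) * A ξ := by
  refine A.integrable.mono ?_ (.of_forall fun ξ ↦ (norm_oscillation _ _).le)
  have := A.continuous
  exact Continuous.aestronglyMeasurable (by fun_prop)

theorem integral_oscillation_by_parts {φ φ' v : ℝ → ℝ} (hφ : ∀ x, HasDerivAt φ (φ' x) x)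
    (hv : v.HasTemperateGrowth) (hvφ : ∀ x, φ' x * v x = 1) (A : SchwartzMap ℝ ℂ) (t : ℝ) :
    Complex.I * t * (∫ ξ, Complex.exp (Complex.I * ((φ ξ * t : ℝ) : ℂ)) * A ξ) =
      -∫ ξ, Complex.exp (Complex.I * ((φ ξ * t : ℝ) : ℂ)) *
        SchwartzMap.derivCLM ℝ ℂ (SchwartzMap.smulLeftCLM ℂ v A) ξ := by
  have hc : Continuous φ := continuous_iff_continuousAt.2 fun x ↦ (hφ x).continuousAt
  set B := SchwartzMap.smulLeftCLM ℂ v A with hB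
  have hI := integrable_oscillation hc A t
  have hI' := integrable_oscillation hc (SchwartzMap.derivCLM ℝ ℂ B) t
  have hz := integral_eq_zero_of_hasDerivAt_of_integrable
    (f := fun ξ ↦ Complex.exp (Complex.I * ((φ ξ * t : ℝ) : ℂ)) * B ξ)
    (f' := fun ξ ↦ Complex.I * t * (Complex.exp (Complex.I * ((φ ξ * t : ℝ) : ℂ)) * A ξ) +
      Complex.exp (Complex.I * ((φ ξ * t : ℝ) : ℂ)) * SchwartzMap.derivCLM ℝ ℂ B ξ)
    (fun x ↦ ?_) ((hI.const_mul _).add hI') (integrable_oscillation hc B t)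
  · rw [integral_add (hI.const_mul _) hI', integral_const_mul] at hz
    exact eq_neg_of_add_eq_zero_left hz
  · have h1 := ((((hφ x).mul_const t).ofReal_comp).const_mul Complex.I).cexp
    have h2 := (B.differentiable x).hasDerivAt
    refine (h1.mul h2).congr_deriv ?_
    have h3 : (φ' x : ℂ) * v x = 1 := by exact_mod_cast hvφ x
    have h4 : B x = v x * A x := by simp [hB, hv]
    simp only [SchwartzMap.derivCLM_apply, h4]
    push_cast
    linear_combination (Complex.exp (Complex.I * (φ x * t)) * Complex.I * t * A x) * h3

theorem oscillatory_integral_rapid_decay {φ φ' v : ℝ → ℝ} (hφ : ∀ x, HasDerivAt φ (φ' x) x)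
    (hv : v.HasTemperateGrowth) (hvφ : ∀ x, φ' x * v x = 1) (n : ℕ) (A : SchwartzMap ℝ ℂ) :
    ∃ C > (0 : ℝ), ∀ t ≥ (1 : ℝ),
      ‖∫ ξ, Complex.exp (Complex.I * ((φ ξ * t : ℝ) : ℂ)) * A ξ‖ ≤ C / t ^ n := by
  induction n generalizing A with
  | zero =>
    refine ⟨(∫ ξ, ‖A ξ‖) + 1, by positivity, fun t _ ↦ ?_⟩
    refine (norm_integral_le_integral_norm _).trans ?_
    simp only [norm_oscillation, pow_zero, div_one]
    linarith
  | succ n ih =>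
    obtain ⟨C, hC, h⟩ := ih (SchwartzMap.derivCLM ℝ ℂ (SchwartzMap.smulLeftCLM ℂ v A))
    refine ⟨C, hC, fun t ht ↦ ?_⟩
    have ht0 : 0 < t := by linarith
    have e := congrArg norm (integral_oscillation_by_parts hφ hv hvφ A t)
    rw [norm_neg, norm_mul, norm_mul, Complex.norm_I, one_mul, Complex.norm_real,
      Real.norm_of_nonneg ht0.le] at e
    have hb := h t ht
    rw [← e] at hb
    rw [pow_succ, ← div_div, le_div_iff₀ ht0]
    linarith

/-! ### The dispersion relation -/

section Dispersion

variable {g H : ℝ} {w : ℝ → ℝ}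

theorem dispersion_eq_mul_sqrt (hH : 0 < H)
    (hw : ∀ ξ, w ξ = Real.sign ξ * Real.sqrt (g * |ξ| * Real.tanh (H * |ξ|))) (ξ : ℝ) :
    w ξ = ξ * Real.sqrt (g * H * dslope Real.tanh 0 (H * ξ)) := by
  rw [hw]
  rcases lt_trichotomy ξ 0 with hξ | rfl | hξ
  · have hne : H * ξ ≠ 0 := mul_ne_zero hH.ne' hξ.ne
    have e : g * |ξ| * Real.tanh (H * |ξ|) = (-ξ) ^ 2 * (g * H * dslope Real.tanh 0 (H * ξ)) := by
      rw [dslope_tanh_of_ne hne, abs_of_neg hξ, mul_neg H, Real.tanh_neg]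
      field_simp [hξ.ne]
    rw [e, Real.sqrt_mul (by positivity), Real.sqrt_sq (by linarith), Real.sign_of_neg hξ]
    ring
  · simp
  · have hne : H * ξ ≠ 0 := mul_ne_zero hH.ne' hξ.ne'
    have e : g * |ξ| * Real.tanh (H * |ξ|) = ξ ^ 2 * (g * H * dslope Real.tanh 0 (H * ξ)) := by
      rw [dslope_tanh_of_ne hne, abs_of_pos hξ]
      field_simp [hξ.ne']
    rw [e, Real.sqrt_mul (by positivity), Real.sqrt_sq hξ.le, Real.sign_of_pos hξ]
    ring

theorem contDiff_dispersion (hg : 0 < g) (hH : 0 < H)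
    (hw : ∀ ξ, w ξ = Real.sign ξ * Real.sqrt (g * |ξ| * Real.tanh (H * |ξ|))) :
    ContDiff ℝ ∞ w := by
  rw [funext (dispersion_eq_mul_sqrt hH hw)]
  have hd : ContDiff ℝ ∞ (dslope Real.tanh 0) :=
    contDiff_iff_contDiffAt.2 fun x ↦ (analyticAt_dslope_tanh x).contDiffAt
  have hd' : ContDiff ℝ ∞ fun ξ ↦ dslope Real.tanh 0 (H * ξ) :=
    hd.comp (contDiff_const.mul contDiff_id)
  exact contDiff_id.mul ((contDiff_const.mul hd').sqrt fun ξ ↦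
    (mul_pos (mul_pos hg hH) (dslope_tanh_pos _)).ne')

theorem dispersion_sq (hg : 0 < g) (hH : 0 < H)
    (hw : ∀ ξ, w ξ = Real.sign ξ * Real.sqrt (g * |ξ| * Real.tanh (H * |ξ|))) (ξ : ℝ) :
    w ξ ^ 2 = g * (ξ * Real.tanh (H * ξ)) := by
  rw [dispersion_eq_mul_sqrt hH hw ξ, mul_pow,
    Real.sq_sqrt (mul_pos (mul_pos hg hH) (dslope_tanh_pos _)).le]
  by_cases hξ : ξ = 0
  · simp [hξ]
  · rw [dslope_tanh_of_ne (mul_ne_zero hH.ne' hξ)]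
    field_simp

theorem dispersion_ne_zero (hg : 0 < g) (hH : 0 < H)
    (hw : ∀ ξ, w ξ = Real.sign ξ * Real.sqrt (g * |ξ| * Real.tanh (H * |ξ|))) {ξ : ℝ}
    (hξ : ξ ≠ 0) : w ξ ≠ 0 := by
  rw [dispersion_eq_mul_sqrt hH hw]
  exact mul_ne_zero hξ (Real.sqrt_pos.2 (mul_pos (mul_pos hg hH) (dslope_tanh_pos _))).ne'

theorem two_mul_dispersion_mul_deriv (hg : 0 < g) (hH : 0 < H)
    (hw : ∀ ξ, w ξ = Real.sign ξ * Real.sqrt (g * |ξ| * Real.tanh (H * |ξ|))) (ξ : ℝ) :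
    2 * (w ξ * deriv w ξ) =
      g * (Real.tanh (H * ξ) + H * ξ * (1 - Real.tanh (H * ξ) ^ 2)) := by
  have h1 := (((contDiff_dispersion hg hH hw).differentiable (by simp)) ξ).hasDerivAt.fun_pow 2
  have h2 := ((hasDerivAt_id ξ).mul
    ((hasDerivAt_tanh (H * ξ)).comp ξ ((hasDerivAt_id ξ).const_mul H))).const_mul g
  rw [funext (dispersion_sq hg hH hw)] at h1
  have h3 := h1.unique h2
  simp at h3
  linear_combination h3

theorem abs_deriv_dispersion_le (hg : 0 < g) (hH : 0 < H)
    (hw : ∀ ξ, w ξ = Real.sign ξ * Real.sqrt (g * |ξ| * Real.tanh (H * |ξ|))) (ξ : ℝ) :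
    |deriv w ξ| ≤ Real.sqrt (g * H) := by
  have hc : Continuous (deriv w) := (contDiff_dispersion hg hH hw).continuous_deriv (by simp)
  have hd : Dense {ξ : ℝ | ξ ≠ 0} := dense_compl_singleton 0
  have hcl : IsClosed {ξ | |deriv w ξ| ≤ Real.sqrt (g * H)} :=
    isClosed_le hc.abs continuous_const
  refine hcl.closure_subset_iff.2 (fun ξ hξ ↦ ?_) (hd ξ)
  have hne := dispersion_ne_zero hg hH hw hξ
  refine Real.abs_le_sqrt ?_
  have h1 := two_mul_dispersion_mul_deriv hg hH hw ξ
  have h2 := dispersion_sq hg hH hw ξ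
  have h3 := mul_le_mul_of_nonneg_left (tanh_add_mul_sq_le (H * ξ)) (sq_nonneg g)
  have h4 : 4 * w ξ ^ 2 * deriv w ξ ^ 2 ≤ 4 * w ξ ^ 2 * (g * H) := by
    calc 4 * w ξ ^ 2 * deriv w ξ ^ 2 = (2 * (w ξ * deriv w ξ)) ^ 2 := by ring
      _ ≤ 4 * w ξ ^ 2 * (g * H) := by
        rw [h1, h2, mul_pow]; linarith
  exact le_of_mul_le_mul_left h4 (by positivity)

theorem growthOn_tanh (s : Set ℝ) (n : ℕ) : GrowthOn s n fun ξ ↦ Real.tanh (H * ξ) := by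
  have h0 : PolyBoundedOn s fun ξ ↦ Real.tanh (H * ξ) :=
    .of_bounded 1 fun ξ _ ↦ (Real.abs_tanh_lt_one _).le
  induction n with
  | zero => exact .zero h0
  | succ n ih =>
    refine .succ h0 (fun ξ _ ↦ ?_) ((GrowthOn.const H).mul
      ((GrowthOn.const 1).add ((GrowthOn.const (-1)).mul (ih.mul ih))))
    exact ((hasDerivAt_tanh (H * ξ)).comp ξ ((hasDerivAt_id ξ).const_mul H)).congr_deriv (by ring)

theorem le_abs_dispersion (hg : 0 < g) (hH : 0 < H)
    (hw : ∀ ξ, w ξ = Real.sign ξ * Real.sqrt (g * |ξ| * Real.tanh (H * |ξ|))) {ξ : ℝ}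
    (hξ : 1 < |ξ|) : Real.sqrt (g * Real.tanh H) ≤ |w ξ| := by
  refine Real.sqrt_le_iff.2 ⟨abs_nonneg _, ?_⟩
  have e : ξ * Real.tanh (H * ξ) = |ξ| * Real.tanh (H * |ξ|) := by
    rcases abs_cases ξ with h | h <;> rw [h.1]
    rw [mul_neg, Real.tanh_neg, neg_mul_neg]
  rw [sq_abs, dispersion_sq hg hH hw, e]
  have h1 : Real.tanh H ≤ Real.tanh (H * |ξ|) := strictMono_tanh.monotone (by nlinarith)
  have h2 := tanh_pos hH
  gcongr
  nlinarith

theorem polyBoundedOn_dispersion (hg : 0 < g) (hH : 0 < H)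
    (hw : ∀ ξ, w ξ = Real.sign ξ * Real.sqrt (g * |ξ| * Real.tanh (H * |ξ|))) (s : Set ℝ) :
    PolyBoundedOn s w := by
  refine ⟨1, 1 + g, fun ξ _ ↦ abs_le_of_sq_le_sq ?_ (by positivity)⟩
  have h1 : ξ * Real.tanh (H * ξ) ≤ |ξ| := by
    refine (le_abs_self _).trans ?_
    rw [abs_mul]
    exact mul_le_of_le_one_right (abs_nonneg _) (Real.abs_tanh_lt_one _).le
  rw [dispersion_sq hg hH hw]
  have h2 : g * |ξ| ≤ (1 + g) * (1 + |ξ|) := by nlinarith [abs_nonneg ξ]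
  have h3 : 1 ≤ (1 + g) * (1 + |ξ|) := by nlinarith [abs_nonneg ξ, mul_nonneg hg.le (abs_nonneg ξ)]
  nlinarith [mul_le_mul_of_nonneg_left h1 hg.le]

theorem growthOn_dispersion (hg : 0 < g) (hH : 0 < H)
    (hw : ∀ ξ, w ξ = Real.sign ξ * Real.sqrt (g * |ξ| * Real.tanh (H * |ξ|))) (n : ℕ) :
    GrowthOn {ξ | 1 < |ξ|} n w := by
  have hδ : 0 < Real.sqrt (g * Real.tanh H) := Real.sqrt_pos.2 (mul_pos hg (tanh_pos hH))
  have hdiff := (contDiff_dispersion hg hH hw).differentiable (by simp)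
  have h0 := polyBoundedOn_dispersion hg hH hw {ξ | 1 < |ξ|}
  induction n with
  | zero => exact .zero h0
  | succ n ih =>
    have hT := growthOn_tanh (H := H) {ξ | 1 < |ξ|} n
    have hnum := hT.add (((GrowthOn.const H).mul .id).mul
      ((GrowthOn.const 1).add ((GrowthOn.const (-1)).mul (hT.mul hT))))
    refine .succ h0 (fun ξ hξ ↦ ?_) (((GrowthOn.const (g / 2)).mul hnum).mul
      (ih.inv hδ fun ξ hξ ↦ le_abs_dispersion hg hH hw hξ))
    have hne : w ξ ≠ 0 := abs_pos.1 (hδ.trans_le (le_abs_dispersion hg hH hw hξ))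
    refine (hdiff ξ).hasDerivAt.congr_deriv ?_
    rw [eq_mul_inv_iff_mul_eq₀ hne]
    linear_combination (1 / 2) * two_mul_dispersion_mul_deriv hg hH hw ξ

theorem phase_deriv_ne_zero (hg : 0 < g) (hH : 0 < H)
    (hw : ∀ ξ, w ξ = Real.sign ξ * Real.sqrt (g * |ξ| * Real.tanh (H * |ξ|))) {c : ℝ}
    (hc : Real.sqrt (g * H) < |c|) (ξ : ℝ) : c - deriv w ξ ≠ 0 := by
  intro h
  rw [sub_eq_zero.1 h] at hc
  exact (abs_deriv_dispersion_le hg hH hw ξ).not_gt hc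

theorem hasTemperateGrowth_inv_phase_deriv (hg : 0 < g) (hH : 0 < H)
    (hw : ∀ ξ, w ξ = Real.sign ξ * Real.sqrt (g * |ξ| * Real.tanh (H * |ξ|))) {c : ℝ}
    (hc : Real.sqrt (g * H) < |c|) :
    (fun ξ ↦ (c - deriv w ξ)⁻¹).HasTemperateGrowth := by
  have hb (ξ : ℝ) : |c| - Real.sqrt (g * H) ≤ |c - deriv w ξ| := by
    linarith [abs_sub_abs_le_abs_sub c (deriv w ξ), abs_deriv_dispersion_le hg hH hw ξ]
  have hsm : ContDiff ℝ ∞ (deriv w) :=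
    (contDiff_infty_iff_deriv.1 (contDiff_dispersion hg hH hw)).2
  refine hasTemperateGrowth_of_growthOn ((contDiff_const.sub hsm).inv (phase_deriv_ne_zero hg hH hw hc))
    1 fun n ↦ ?_
  have hd := (growthOn_dispersion hg hH hw (n + 1)).deriv
    (isOpen_lt continuous_const continuous_abs)
  refine GrowthOn.inv (sub_pos.2 hc) (fun ξ _ ↦ hb ξ) ?_
  simpa [sub_eq_add_neg] using (GrowthOn.const c).add ((GrowthOn.const (-1)).mul hd)

end Dispersion

end WaterWaves

/-- Rapid decay of the oscillatory integral `∫ exp(i(cξ − ω(ξ))t) A(ξ) dξ`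
along non-characteristic rays `|c| > √(gH)`, where
`ω(ξ) = sgn(ξ)√(g|ξ| tanh(H|ξ|))` and `A` is Schwartz: for every `n` there is
`C > 0` with `|I(t)| ≤ C t⁻ⁿ` for all `t ≥ 1`. -/
theorem stmt_6 (g H : ℝ) (hg : 0 < g) (hH : 0 < H)
    (ω : ℝ → ℝ)
    (hω : ∀ ξ, ω ξ = Real.sign ξ * Real.sqrt (g * |ξ| * Real.tanh (H * |ξ|)))
    (A : SchwartzMap ℝ ℂ) (c : ℝ) (hc : Real.sqrt (g * H) < |c|) :
    ∀ n : ℕ, ∃ C > (0 : ℝ), ∀ t ≥ (1 : ℝ),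
      ‖∫ ξ : ℝ, Complex.exp (Complex.I * (((c * ξ - ω ξ) * t : ℝ) : ℂ)) * A ξ‖
        ≤ C / t ^ n := by
  intro n
  have hd := (WaterWaves.contDiff_dispersion hg hH hω).differentiable (by simp)
  exact WaterWaves.oscillatory_integral_rapid_decay
    (fun x ↦ (((hasDerivAt_id x).const_mul c).congr_deriv (mul_one c)).sub (hd x).hasDerivAt)
    (WaterWaves.hasTemperateGrowth_inv_phase_deriv hg hH hω hc)
    (fun x ↦ mul_inv_cancel₀ (WaterWaves.phase_deriv_ne_zero hg hH hω hc x)) n A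
end

section
/- Let g > 0, H > 0, c₀ = √(gH), and let ω : ℝ → ℝ be the smooth odd function ω(ξ) = sgn(ξ)·√(g|ξ| tanh(H|ξ|)) (extended smoothly through ξ = 0 as in ω(ξ) = ξ·√(g·tanh(Hξ)/ξ) with the convention tanh(Hξ)/ξ = H at ξ = 0). Let A : ℝ → ℂ be a Schwartz function. Then the oscillatory integral I(t) = ∫_ℝ exp(i(c₀ξ − ω(ξ))t) A(ξ) dξ satisfies I(t) = O(t^{−1/3}) as t → +∞, i.e., there exists C > 0 with |I(t)| ≤ C t^{−1/3} for all t ≥ 1. -/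
open MeasureTheory Set Filter Topology

theorem Real.hasDerivAt_tanh_one_sub_sq (x : ℝ) :
    HasDerivAt Real.tanh (1 - Real.tanh x ^ 2) x := by
  have hc := (Real.cosh_pos x).ne'
  have h := (Real.hasDerivAt_sinh x).div (Real.hasDerivAt_cosh x) hc
  have he : Real.tanh = Real.sinh / Real.cosh := by
    ext y; simp [Real.tanh_eq_sinh_div_cosh]
  rw [he]
  refine h.congr_deriv ?_
  rw [Pi.div_apply]
  field_simp

theorem Real.one_add_sq_div_two_le_cosh (x : ℝ) : 1 + x ^ 2 / 2 ≤ Real.cosh x := by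
  have h := Real.cosh_two_mul (x / 2)
  rw [mul_div_cancel₀ x two_ne_zero, Real.cosh_sq] at h
  have h2 : (x / 2) ^ 2 ≤ Real.sinh (x / 2) ^ 2 := by
    rw [sq_le_sq, Real.abs_sinh]
    exact Real.self_le_sinh_iff.2 (abs_nonneg _)
  nlinarith

/-- The derivative of `y ↦ √(y tanh y)` on `y > 0`. -/
noncomputable def dispersionDeriv (y : ℝ) : ℝ :=
  (Real.tanh y + y * (1 - Real.tanh y ^ 2)) / (2 * √(y * Real.tanh y))

theorem Real.tanh_pos_of_pos {y : ℝ} (hy : 0 < y) : 0 < Real.tanh y := by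
  rw [Real.tanh_eq_sinh_div_cosh]
  exact div_pos (Real.sinh_pos_iff.2 hy) (Real.cosh_pos y)

theorem Real.tanh_le_self {y : ℝ} (hy : 0 ≤ y) : Real.tanh y ≤ y := by
  have hd : ∀ x, HasDerivAt (fun x => x - Real.tanh x) (Real.tanh x ^ 2) x := fun x => by
    simpa using! (hasDerivAt_id x).sub (Real.hasDerivAt_tanh_one_sub_sq x)
  have hm : Monotone fun x => x - Real.tanh x :=
    monotone_of_hasDerivAt_nonneg hd fun x => sq_nonneg _
  simpa using hm hy

theorem hasDerivAt_mul_tanh (y : ℝ) :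
    HasDerivAt (fun y => y * Real.tanh y) (Real.tanh y + y * (1 - Real.tanh y ^ 2)) y := by
  simpa using! (hasDerivAt_id y).mul (Real.hasDerivAt_tanh_one_sub_sq y)

theorem hasDerivAt_sqrt_mul_tanh {y : ℝ} (hy : 0 < y) :
    HasDerivAt (fun y => √(y * Real.tanh y)) (dispersionDeriv y) y :=
  (hasDerivAt_mul_tanh y).sqrt (mul_pos hy (Real.tanh_pos_of_pos hy)).ne'

theorem exists_hasDerivAt_dispersionDeriv_nonpos {y : ℝ} (hy : 0 < y) :
    ∃ q ≤ 0, HasDerivAt dispersionDeriv q y := by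
  have hT := Real.tanh_pos_of_pos hy
  have hf := mul_pos hy hT
  have hW := Real.sqrt_pos.2 hf
  have hWsq := Real.sq_sqrt hf.le
  have htanh := Real.hasDerivAt_tanh_one_sub_sq y
  have h1 := htanh.add ((hasDerivAt_id y).mul ((htanh.pow 2).const_sub 1))
  have h2 := h1.div ((hasDerivAt_sqrt_mul_tanh hy).const_mul 2) (mul_pos two_pos hW).ne'
  refine ⟨_, ?_, h2⟩
  refine div_nonpos_of_nonpos_of_nonneg ?_ (sq_nonneg _)
  have hS : 0 ≤ 1 - Real.tanh y ^ 2 := by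
    nlinarith [Real.tanh_lt_one y]
  simp only [dispersionDeriv, id, Pi.pow_apply, Pi.mul_apply, Pi.add_apply]
  set T := Real.tanh y
  set W := √(y * T)
  have key : 2 * W ^ 2 * (2 * (1 - T ^ 2) - 2 * y * T * (1 - T ^ 2))
      - (T + y * (1 - T ^ 2)) ^ 2 ≤ 0 := by
    rw [hWsq]
    nlinarith [sq_nonneg (T - y * (1 - T ^ 2)), mul_nonneg (sq_nonneg (y * T)) hS]
  refine le_of_eq_of_le ?_ (div_nonpos_of_nonpos_of_nonneg key hW.le)
  field_simp
  push_cast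
  ring

theorem div_le_one_sub_dispersionDeriv {y : ℝ} (hy : 0 < y) :
    y ^ 2 / (2 * (2 + y ^ 2)) ≤ 1 - dispersionDeriv y := by
  have hT := Real.tanh_pos_of_pos hy
  have hf := mul_pos hy hT
  have hW := Real.sqrt_pos.2 hf
  have hc := Real.cosh_pos y
  have hs := Real.self_le_sinh_iff.2 hy.le
  have hcy := Real.one_add_sq_div_two_le_cosh y
  have hcs := Real.cosh_sq y
  have hST : 1 - Real.tanh y ^ 2 = 1 / Real.cosh y ^ 2 := by
    rw [Real.tanh_eq_sinh_div_cosh]; field_simp; linarith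
  have hTy := Real.tanh_le_self hy.le
  have hTW : Real.tanh y ≤ √(y * Real.tanh y) := by
    apply Real.le_sqrt_of_sq_le; nlinarith
  have hyS : y * (1 - Real.tanh y ^ 2) ≤ Real.tanh y / Real.cosh y := by
    rw [hST, Real.tanh_eq_sinh_div_cosh]
    field_simp
    exact hs
  have hinv : 1 / Real.cosh y ≤ 1 / (1 + y ^ 2 / 2) :=
    one_div_le_one_div_of_le (by positivity) hcy
  have h : dispersionDeriv y ≤ (1 + 1 / (1 + y ^ 2 / 2)) / 2 := by
    rw [dispersionDeriv, div_le_div_iff₀ (by positivity) two_pos]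
    have h3 : Real.tanh y / Real.cosh y ≤ Real.tanh y * (1 / (1 + y ^ 2 / 2)) := by
      rw [div_eq_mul_one_div]; gcongr
    have h4 : Real.tanh y * (1 + 1 / (1 + y ^ 2 / 2)) ≤
      √(y * Real.tanh y) * (1 + 1 / (1 + y ^ 2 / 2)) := by gcongr
    linarith
  refine le_trans (le_of_eq ?_) (sub_le_sub_left h 1)
  field_simp
  ring

/-- First derivative test for oscillatory integrals with a phase whose derivative `p` is positive and
nondecreasing. -/
theorem norm_intervalIntegral_exp_mul_le {φ p q : ℝ → ℝ} {B B' : ℝ → ℂ} {a b t M : ℝ}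
    (hab : a ≤ b) (ht : t ≠ 0)
    (hφ : ∀ x ∈ Icc a b, HasDerivAt φ (p x) x) (hp : ∀ x ∈ Icc a b, HasDerivAt p (q x) x)
    (hp0 : ∀ x ∈ Icc a b, 0 < p x) (hq : ∀ x ∈ Icc a b, 0 ≤ q x)
    (hB : ∀ x, HasDerivAt B (B' x) x) (hB' : Integrable B') (hM : ∀ x, ‖B x‖ ≤ M) :
    ‖∫ x in a..b, Complex.exp (Complex.I * ((φ x * t : ℝ) : ℂ)) * B x‖
      ≤ (3 * M + ∫ x, ‖B' x‖) / (|t| * p a) := by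
  have hM0 : 0 ≤ M := (norm_nonneg _).trans (hM 0)
  rw [← uIcc_of_le hab] at hφ hp hp0 hq
  have hpc : ContinuousOn p (uIcc a b) := fun x hx => (hp x hx).continuousAt.continuousWithinAt
  have hφc : ContinuousOn φ (uIcc a b) := fun x hx => (hφ x hx).continuousAt.continuousWithinAt
  have hBc : Continuous B := continuous_iff_continuousAt.2 fun x => (hB x).continuousAt
  set ψ : ℝ → ℝ := fun x => (p x)⁻¹ with hψdef
  set d : ℝ → ℝ := fun x => q x / p x ^ 2 with hddef
  have hψ : ∀ x ∈ uIcc a b, HasDerivAt ψ (-d x) x := fun x hx =>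
    ((hp x hx).inv (hp0 x hx).ne').congr_deriv (neg_div _ _)
  have hd0 : ∀ x ∈ uIcc a b, 0 ≤ d x := fun x hx => div_nonneg (hq x hx) (sq_nonneg _)
  have hψc : ContinuousOn ψ (uIcc a b) := fun x hx => (hψ x hx).continuousAt.continuousWithinAt
  have hIoo : ∀ x ∈ Ioo (min a b) (max a b), x ∈ uIcc a b := fun x hx => Ioo_subset_Icc_self hx
  have hdint : IntervalIntegrable d volume a b :=
    intervalIntegral.intervalIntegrable_deriv_of_nonneg (g := fun x => -ψ x) hψc.neg
      (fun x hx => by simpa using! (hψ x (hIoo x hx)).neg) (fun x hx => hd0 x (hIoo x hx))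
  have hdI : ∫ x in a..b, d x = ψ a - ψ b := by
    rw [intervalIntegral.integral_eq_sub_of_hasDerivAt (f := fun x => -ψ x)
      (fun x hx => by simpa using! (hψ x hx).neg) hdint]
    ring
  have ha : a ∈ uIcc a b := left_mem_uIcc
  have hb : b ∈ uIcc a b := right_mem_uIcc
  have hψpos : ∀ x ∈ uIcc a b, 0 < ψ x := fun x hx => inv_pos.2 (hp0 x hx)
  have hanti : AntitoneOn ψ (Icc a b) := by
    rw [← uIcc_of_le hab]
    refine antitoneOn_of_deriv_nonpos (convex_uIcc a b) hψc ?_ ?_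
    · exact fun x hx => (hψ x (interior_subset hx)).differentiableAt.differentiableWithinAt
    · exact fun x hx => by
        rw [(hψ x (interior_subset hx)).deriv]
        exact neg_nonpos.2 (hd0 x (interior_subset hx))
  have hψa : ∀ x ∈ Icc a b, ψ x ≤ ψ a := fun x hx => hanti (left_mem_Icc.2 hab) hx hx.1
  set e : ℝ → ℂ := fun x => Complex.exp (Complex.I * ((φ x * t : ℝ) : ℂ)) with hedef
  have hec : ContinuousOn e (uIcc a b) := by
    simp only [hedef]; fun_prop
  have hen : ∀ x, ‖e x‖ = 1 := fun x => by
    rw [hedef]; simp only [mul_comm Complex.I]; exact Complex.norm_exp_ofReal_mul_I _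
  have he : ∀ x ∈ uIcc a b, HasDerivAt e (e x * (Complex.I * ((p x * t : ℝ) : ℂ))) x :=
    fun x hx => ((((hφ x hx).mul_const t).ofReal_comp).const_mul Complex.I).cexp
  set u : ℝ → ℂ := fun x => B x * (ψ x : ℂ) with hudef
  have hu : ∀ x ∈ uIcc a b, HasDerivAt u (B' x * (ψ x : ℂ) + B x * ((-d x : ℝ) : ℂ)) x :=
    fun x hx => (hB x).mul (hψ x hx).ofReal_comp
  have hψcC : ContinuousOn (fun x => (ψ x : ℂ)) (uIcc a b) :=
    Complex.continuous_ofReal.comp_continuousOn hψc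
  have hu'1 : IntervalIntegrable (fun x => B' x * (ψ x : ℂ)) volume a b :=
    hB'.intervalIntegrable.mul_continuousOn hψcC
  have hu'2 : IntervalIntegrable (fun x => B x * ((-d x : ℝ) : ℂ)) volume a b :=
    IntervalIntegrable.continuousOn_mul
      ⟨hdint.neg.1.ofReal, hdint.neg.2.ofReal⟩ hBc.continuousOn
  have hv' : IntervalIntegrable (fun x => e x * (Complex.I * ((p x * t : ℝ) : ℂ))) volume a b := by
    apply ContinuousOn.intervalIntegrable
    fun_prop
  have parts := intervalIntegral.integral_mul_deriv_eq_deriv_mul hu he (hu'1.add hu'2) hv'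
  have hlhs : ∫ x in a..b, u x * (e x * (Complex.I * ((p x * t : ℝ) : ℂ)))
      = Complex.I * (t : ℂ) * ∫ x in a..b, e x * B x := by
    rw [← intervalIntegral.integral_const_mul]
    refine intervalIntegral.integral_congr fun x hx => ?_
    have : (p x : ℂ) ≠ 0 := by exact_mod_cast (hp0 x hx).ne'
    simp only [hudef, hψdef]
    push_cast
    field_simp
  have hbdu : ∀ x ∈ Icc a b, ‖u x‖ ≤ M * ψ a := fun x hx => by
    rw [hudef]
    simp only [norm_mul, Complex.norm_real, Real.norm_eq_abs]
    rw [abs_of_pos (hψpos x (uIcc_of_le hab ▸ hx))]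
    exact mul_le_mul (hM x) (hψa x hx) (hψpos x (uIcc_of_le hab ▸ hx)).le hM0
  have hint : ‖∫ x in a..b, (B' x * (ψ x : ℂ) + B x * ((-d x : ℝ) : ℂ)) * e x‖
      ≤ (∫ x in a..b, (‖B' x‖ * ψ a + M * d x)) := by
    refine intervalIntegral.norm_integral_le_of_norm_le hab (ae_of_all _ fun x hx => ?_)
      ((hB'.norm.intervalIntegrable.mul_const _).add (hdint.const_mul _))
    have hx' : x ∈ Icc a b := Ioc_subset_Icc_self hx
    have hx'' : x ∈ uIcc a b := uIcc_of_le hab ▸ hx'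
    rw [norm_mul, hen, mul_one]
    refine (norm_add_le _ _).trans ?_
    simp only [norm_mul, Complex.norm_real, Real.norm_eq_abs, abs_neg]
    rw [abs_of_pos (hψpos x hx''), abs_of_nonneg (hd0 x hx'')]
    exact add_le_add (mul_le_mul_of_nonneg_left (hψa x hx') (norm_nonneg _))
      (mul_le_mul_of_nonneg_right (hM x) (hd0 x hx''))
  rw [intervalIntegral.integral_add (hB'.norm.intervalIntegrable.mul_const _)
    (hdint.const_mul _), intervalIntegral.integral_mul_const,
    intervalIntegral.integral_const_mul, hdI] at hint
  have hN : ∫ x in a..b, ‖B' x‖ ≤ ∫ x, ‖B' x‖ := by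
    rw [intervalIntegral.integral_of_le hab]
    exact setIntegral_le_integral hB'.norm (ae_of_all _ fun x => norm_nonneg _)
  have hfin : |t| * ‖∫ x in a..b, e x * B x‖ ≤ (3 * M + ∫ x, ‖B' x‖) * ψ a := by
    have h1 : |t| * ‖∫ x in a..b, e x * B x‖
        = ‖Complex.I * (t : ℂ) * ∫ x in a..b, e x * B x‖ := by
      simp
    rw [h1, ← hlhs, parts]
    refine (norm_sub_le _ _).trans ?_
    have h2 : ‖u b * e b - u a * e a‖ ≤ M * ψ a + M * ψ a := by
      refine (norm_sub_le _ _).trans ?_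
      rw [norm_mul (u b), norm_mul (u a), hen, hen, mul_one, mul_one]
      exact add_le_add (hbdu b (right_mem_Icc.2 hab)) (hbdu a (left_mem_Icc.2 hab))
    have h3 := mul_le_mul_of_nonneg_right hN (hψpos a ha).le
    have h4 := mul_nonneg hM0 (hψpos b hb).le
    linarith
  have htp := abs_pos.2 ht
  have hpa := hp0 a ha
  rw [le_div_iff₀ (mul_pos htp hpa)]
  calc _ = (|t| * ‖∫ x in a..b, e x * B x‖) * p a := by ring
    _ ≤ ((3 * M + ∫ x, ‖B' x‖) * ψ a) * p a := mul_le_mul_of_nonneg_right hfin hpa.le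
    _ = _ := by simp only [hψdef]; field_simp

/-- A phase whose derivative is positive and nondecreasing on `(0, ∞)` and at least `c x ^ 2` near
the origin gives a half-line oscillatory integral of size `δ = |t| ^ (-1 / 3)`. -/
theorem norm_integral_Ioi_exp_mul_le {φ p q : ℝ → ℝ} {B B' : ℝ → ℂ} {t M c δ : ℝ}
    (hφ : ∀ x, 0 < x → HasDerivAt φ (p x) x) (hp : ∀ x, 0 < x → HasDerivAt p (q x) x)
    (hp0 : ∀ x, 0 < x → 0 < p x) (hq : ∀ x, 0 < x → 0 ≤ q x)
    (hc : 0 < c) (hpc : ∀ x, 0 < x → x ≤ 1 → c * x ^ 2 ≤ p x)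
    (hB : ∀ x, HasDerivAt B (B' x) x) (hBi : Integrable B) (hB' : Integrable B')
    (hM : ∀ x, ‖B x‖ ≤ M) (hδ : 0 < δ) (hδ1 : δ ≤ 1) (ht : |t| * δ ^ 3 = 1) :
    IntegrableOn (fun x => Complex.exp (Complex.I * ((φ x * t : ℝ) : ℂ)) * B x) (Ioi 0) ∧
    ‖∫ x in Ioi 0, Complex.exp (Complex.I * ((φ x * t : ℝ) : ℂ)) * B x‖
      ≤ (M + (3 * M + ∫ x, ‖B' x‖) / c) * δ := by
  have hM0 : 0 ≤ M := (norm_nonneg _).trans (hM 0)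
  have hN0 : 0 ≤ ∫ x, ‖B' x‖ := integral_nonneg fun x => norm_nonneg _
  have ht0 : t ≠ 0 := by rintro rfl; simp at ht
  set e : ℝ → ℂ := fun x => Complex.exp (Complex.I * ((φ x * t : ℝ) : ℂ)) with hedef
  have hen : ∀ x, ‖e x‖ = 1 := fun x => by
    rw [hedef]; simp only [mul_comm Complex.I]; exact Complex.norm_exp_ofReal_mul_I _
  have hφc : ContinuousOn φ (Ioi 0) := fun x hx => (hφ x hx).continuousAt.continuousWithinAt
  have hec : ContinuousOn e (Ioi 0) := by
    simp only [hedef]; fun_prop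
  have hint : IntegrableOn (fun x => e x * B x) (Ioi 0) :=
    hBi.integrableOn.bdd_mul (c := 1) (hec.aestronglyMeasurable measurableSet_Ioi)
      (ae_of_all _ fun x => (hen x).le)
  refine ⟨hint, ?_⟩
  have hintδ : IntegrableOn (fun x => e x * B x) (Ioi δ) := hint.mono_set (Ioi_subset_Ioi hδ.le)
  have htail : ‖∫ x in Ioi δ, e x * B x‖ ≤ (3 * M + ∫ x, ‖B' x‖) / c * δ := by
    refine le_of_tendsto (intervalIntegral_tendsto_integral_Ioi δ hintδ tendsto_id).norm ?_
    filter_upwards [eventually_ge_atTop δ] with R hR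
    have hpos : ∀ x ∈ Icc δ R, 0 < x := fun x hx => hδ.trans_le hx.1
    refine (norm_intervalIntegral_exp_mul_le hR ht0 (fun x hx => hφ x (hpos x hx))
      (fun x hx => hp x (hpos x hx)) (fun x hx => hp0 x (hpos x hx))
      (fun x hx => hq x (hpos x hx)) hB hB' hM).trans ?_
    have htp := abs_pos.2 ht0
    calc (3 * M + ∫ x, ‖B' x‖) / (|t| * p δ)
        ≤ (3 * M + ∫ x, ‖B' x‖) / (|t| * (c * δ ^ 2)) := by
          gcongr
          exact hpc δ hδ hδ1
      _ = (3 * M + ∫ x, ‖B' x‖) / c * δ := by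
          field_simp
          rw [mul_assoc, ht, mul_one]
  have hhead : ‖∫ x in Ioc 0 δ, e x * B x‖ ≤ M * δ := by
    have := norm_setIntegral_le_of_norm_le_const (μ := volume) (s := Ioc 0 δ) (C := M)
      (f := fun x => e x * B x) measure_Ioc_lt_top
      (fun x _ => by rw [norm_mul, hen, one_mul]; exact hM x)
    simpa [hδ.le] using this
  rw [← Ioc_union_Ioi_eq_Ioi hδ.le, setIntegral_union (Ioc_disjoint_Ioi le_rfl) measurableSet_Ioi
    (hint.mono_set Ioc_subset_Ioi_self) hintδ, add_mul]
  exact (norm_add_le _ _).trans (add_le_add hhead htail)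

/-- Decay `O(t^{-1/3})` of the oscillatory integral along the critical ray
`c₀ = √(gH)`, where `ω(ξ) = sgn(ξ)√(g|ξ| tanh(H|ξ|))` and `A` is Schwartz:
there is `C > 0` with `|I(t)| ≤ C t^{-1/3}` for all `t ≥ 1`. -/
theorem stmt_7 (g H : ℝ) (hg : 0 < g) (hH : 0 < H)
    (c₀ : ℝ) (hc₀ : c₀ = Real.sqrt (g * H))
    (ω : ℝ → ℝ)
    (hω : ∀ ξ, ω ξ = Real.sign ξ * Real.sqrt (g * |ξ| * Real.tanh (H * |ξ|)))
    (A : SchwartzMap ℝ ℂ) :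
    ∃ C > (0 : ℝ), ∀ t ≥ (1 : ℝ),
      ‖∫ ξ : ℝ, Complex.exp (Complex.I * (((c₀ * ξ - ω ξ) * t : ℝ) : ℂ)) * A ξ‖
        ≤ C * t ^ (-(1 / 3 : ℝ)) := by
  have hκ : 0 < √(g / H) := Real.sqrt_pos.2 (div_pos hg hH)
  set κ := √(g / H) with hκdef
  have hc₀κ : c₀ = κ * H := by
    rw [hc₀, hκdef, show g * H = g / H * H ^ 2 by field_simp,
      Real.sqrt_mul (div_pos hg hH).le, Real.sqrt_sq hH.le]
  have hωpos : ∀ x, 0 < x → ω x = κ * √(H * x * Real.tanh (H * x)) := fun x hx => by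
    rw [hω, Real.sign_of_pos hx, abs_of_pos hx, one_mul, hκdef,
      ← Real.sqrt_mul (div_pos hg hH).le]
    congr 1
    field_simp
  have hodd : ∀ x, ω (-x) = -ω x := fun x => by
    rw [hω, hω, abs_neg, Real.sign_neg, neg_mul]
  set p : ℝ → ℝ := fun x => κ * H * (1 - dispersionDeriv (H * x)) with hpdef
  have hφ : ∀ x, 0 < x → HasDerivAt (fun x => c₀ * x - ω x) (p x) x := fun x hx => by
    have h := (hasDerivAt_sqrt_mul_tanh (mul_pos hH hx)).comp x ((hasDerivAt_id x).const_mul H)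
    have h' := ((hasDerivAt_id x).const_mul c₀).sub (h.const_mul κ)
    refine (h'.congr_deriv ?_).congr_of_eventuallyEq ?_
    · rw [hpdef, hc₀κ]; ring
    · filter_upwards [eventually_gt_nhds hx] with y hy
      simp [hωpos y hy]
  have hp : ∀ x, 0 < x → ∃ q, 0 ≤ q ∧ HasDerivAt p q x := fun x hx => by
    obtain ⟨q, hq0, hq⟩ := exists_hasDerivAt_dispersionDeriv_nonpos (mul_pos hH hx)
    have h := ((hq.comp x ((hasDerivAt_id x).const_mul H)).const_sub 1).const_mul (κ * H)
    refine ⟨_, ?_, h⟩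
    have := mul_nonneg (neg_nonneg.2 hq0) hH.le
    exact mul_nonneg (mul_pos hκ hH).le (by simpa using this)
  choose! q hq hpq using hp
  have hplow : ∀ x, 0 < x → κ * H * ((H * x) ^ 2 / (2 * (2 + (H * x) ^ 2))) ≤ p x := fun x hx =>
    mul_le_mul_of_nonneg_left (div_le_one_sub_dispersionDeriv (mul_pos hH hx)) (mul_pos hκ hH).le
  have hp0 : ∀ x, 0 < x → 0 < p x := fun x hx =>
    lt_of_lt_of_le (by positivity) (hplow x hx)
  set c := κ * H * (H ^ 2 / (2 * (2 + H ^ 2))) with hcdef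
  have hc : 0 < c := by positivity
  have hpc : ∀ x, 0 < x → x ≤ 1 → c * x ^ 2 ≤ p x := fun x hx hx1 => by
    refine le_trans ?_ (hplow x hx)
    rw [hcdef, mul_assoc, div_mul_eq_mul_div, ← mul_pow]
    gcongr
    exact mul_le_of_le_one_right hH.le hx1
  set M := SchwartzMap.seminorm ℝ 0 0 A
  have hM : ∀ x, ‖A x‖ ≤ M := A.norm_le_seminorm ℝ
  have hM0 : 0 ≤ M := (norm_nonneg _).trans (hM 0)
  have hA'i : Integrable (deriv A) :=
    (SchwartzMap.derivCLM ℝ ℂ A).integrable.congr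
      (ae_of_all _ fun x => SchwartzMap.derivCLM_apply ℝ A x)
  set N := ∫ x, ‖deriv A x‖
  have hN0 : 0 ≤ N := integral_nonneg fun x => norm_nonneg _
  refine ⟨2 * (M + (3 * M + N) / c) + 1, by positivity, fun t ht => ?_⟩
  have ht0 : 0 < t := one_pos.trans_le ht
  set δ := t ^ (-(1 / 3 : ℝ)) with hδdef
  have hδ : 0 < δ := Real.rpow_pos_of_pos ht0 _
  have hδ1 : δ ≤ 1 := Real.rpow_le_one_of_one_le_of_nonpos ht (by norm_num)
  have hδ3 : t * δ ^ 3 = 1 := by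
    rw [hδdef, ← Real.rpow_natCast, ← Real.rpow_mul ht0.le]
    norm_num
    rw [Real.rpow_neg_one, mul_inv_cancel₀ ht0.ne']
  obtain ⟨hi₁, hb₁⟩ := norm_integral_Ioi_exp_mul_le hφ hpq hp0 hq hc hpc A.hasDerivAt
    A.integrable hA'i hM hδ hδ1 (t := t) (by rwa [abs_of_pos ht0])
  have hBd : ∀ x, HasDerivAt (fun x => A (-x)) (-deriv A (-x)) x := fun x => by
    simpa using! (A.hasDerivAt (-x)).scomp x (hasDerivAt_neg x)
  obtain ⟨hi₂, hb₂⟩ := norm_integral_Ioi_exp_mul_le hφ hpq hp0 hq hc hpc hBd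
    A.integrable.comp_neg hA'i.comp_neg.neg (fun x => hM (-x)) hδ hδ1 (t := -t)
    (by rwa [abs_neg, abs_of_pos ht0])
  have hN : ∫ x, ‖-deriv A (-x)‖ = N := by
    simp only [norm_neg]
    exact integral_neg_eq_self (fun x => ‖deriv A x‖) volume
  rw [hN] at hb₂
  set F : ℝ → ℂ := fun ξ => Complex.exp (Complex.I * (((c₀ * ξ - ω ξ) * t : ℝ) : ℂ)) * A ξ
  have hF : (fun x => Complex.exp (Complex.I * (((c₀ * x - ω x) * -t : ℝ) : ℂ)) * A (-x))
      = fun x => F (-x) := by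
    funext x
    simp only [F, hodd]
    congr 4
    ring
  rw [hF] at hi₂ hb₂
  have hi₃ : IntegrableOn F (Iic 0) := by
    rw [integrableOn_Iic_iff_integrableOn_Iio]
    rw [← (Measure.measurePreserving_neg (volume : Measure ℝ)).integrableOn_comp_preimage
      (Homeomorph.neg ℝ).measurableEmbedding]
    simpa using! hi₂
  rw [integral_comp_neg_Ioi, neg_zero] at hb₂
  rw [← intervalIntegral.integral_Iic_add_Ioi hi₃ hi₁]
  refine (norm_add_le _ _).trans ?_
  linarith
end

section
/- Let c₀ ∈ ℝ and let u₀ : ℝ → ℝ be a bounded C¹ function with bounded derivative. Set q := inf_ℝ u₀' and T* := −2/(3q) if q < 0, T* := +∞ if q ≥ 0. Then there exists a unique C¹ solution u : [0,T*) × ℝ → ℝ of the inviscid Burgers equation ∂_t u + (c₀ + (3/2)u) ∂_x u = 0 with u(0,·) = u₀; it is characterized by the implicit formula u(t, x₀ + (c₀ + (3/2)u₀(x₀))t) = u₀(x₀) for all x₀ ∈ ℝ and t ∈ [0,T*), the characteristic map Φ_t : x₀ ↦ x₀ + (c₀ + (3/2)u₀(x₀))t being a C¹ increasing bijection of ℝ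 for each t ∈ [0,T*). -/
open Set Topology

section Characteristics

variable {a : ℝ → ℝ}

theorem hasDerivAt_characteristic (ha : ContDiff ℝ 1 a) (t x : ℝ) :
    HasDerivAt (fun y => y + a y * t) (1 + deriv a x * t) x :=
  (hasDerivAt_id x).add (((ha.differentiable one_ne_zero) x).hasDerivAt.mul_const t)

theorem strictMono_characteristic (ha : ContDiff ℝ 1 a) {t : ℝ}
    (h : ∀ x, 0 < 1 + deriv a x * t) : StrictMono fun y => y + a y * t :=
  strictMono_of_deriv_pos fun x => by
    rw [(hasDerivAt_characteristic ha t x).deriv]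
    exact h x

theorem surjective_characteristic (ha : Continuous a) {M : ℝ} (hM : ∀ x, |a x| ≤ M) (t : ℝ) :
    Function.Surjective fun y => y + a y * t := by
  have hbound (x : ℝ) : |a x * t| ≤ M * |t| := by
    rw [abs_mul]
    exact mul_le_mul_of_nonneg_right (hM x) (abs_nonneg t)
  intro y
  refine mem_range_of_exists_le_of_exists_ge (by fun_prop)
    ⟨y - M * |t|, ?_⟩ ⟨y + M * |t|, ?_⟩
  · linarith [(abs_le.1 (hbound (y - M * |t|))).2]
  · linarith [(abs_le.1 (hbound (y + M * |t|))).1]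

/-- A left inverse in space of the characteristic maps is `C¹` in space-time. -/
theorem contDiffAt_inverse_characteristic (ha : ContDiff ℝ 1 a) {I : Set ℝ} (hI : IsOpen I)
    (h : ∀ t ∈ I, ∀ x, 0 < 1 + deriv a x * t) {X : ℝ × ℝ → ℝ}
    (hX : ∀ t ∈ I, ∀ x, X (t, x + a x * t) = x) {t : ℝ} (ht : t ∈ I) (x : ℝ) :
    ContDiffAt ℝ 1 X (t, x + a x * t) := by
  let Ψ : ℝ × ℝ → ℝ × ℝ := fun p => (p.1, p.2 + a p.2 * p.1)
  have hΨ : ContDiff ℝ 1 Ψ := by fun_prop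
  let L : (ℝ × ℝ) ≃L[ℝ] (ℝ × ℝ) :=
    (ContinuousLinearEquiv.refl ℝ ℝ).skewProd
      (ContinuousLinearEquiv.unitsEquivAut ℝ (Units.mk0 _ (h t ht x).ne'))
      (a x • ContinuousLinearMap.id ℝ ℝ)
  have hL : HasFDerivAt Ψ (L : (ℝ × ℝ) →L[ℝ] (ℝ × ℝ)) (t, x) := by
    have ha' : HasFDerivAt (fun p : ℝ × ℝ => a p.2)
        (deriv a x • ContinuousLinearMap.snd ℝ ℝ ℝ) (t, x) :=
      ((ha.differentiable one_ne_zero) x).hasDerivAt.comp_hasFDerivAt (t, x) hasFDerivAt_snd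
    refine (hasFDerivAt_fst.prodMk
      (hasFDerivAt_snd.add (ha'.mul hasFDerivAt_fst))).congr_fderiv ?_
    ext <;> simp [L]
    ring
  have hinv : ∀ᶠ p in 𝓝 (t, x), (fun y : ℝ × ℝ => (y.1, X y)) (Ψ p) = p := by
    filter_upwards [(hI.preimage continuous_fst).mem_nhds (show (t, x).1 ∈ I from ht)] with p hp
    exact Prod.ext rfl (hX p.1 hp p.2)
  have hloc := (hΨ.contDiffAt.hasStrictFDerivAt' hL one_ne_zero).localInverse_unique
    (g := fun y => (y.1, X y)) hinv
  exact (((hΨ.contDiffAt (x := (t, x))).to_localInverse hL one_ne_zero).congr_of_eventuallyEq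
    hloc).snd

end Characteristics

section Burgers

variable {c₀ : ℝ} {u₀ : ℝ → ℝ} {S : Set ℝ}

/-- A `C¹` solution of the inviscid Burgers equation is constant along characteristics. -/
theorem eq_initial_of_burgers (hS : ∀ t ∈ S, Icc 0 t ⊆ S)
    (hud : UniqueDiffOn ℝ (S ×ˢ (univ : Set ℝ))) {u : ℝ × ℝ → ℝ}
    (hu : ContDiffOn ℝ 1 u (S ×ˢ univ))
    (heq : ∀ p ∈ S ×ˢ (univ : Set ℝ), fderivWithin ℝ u (S ×ˢ univ) p (1, 0)
      + (c₀ + (3 / 2) * u p) * fderivWithin ℝ u (S ×ˢ univ) p (0, 1) = 0)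
    (h0 : ∀ x, u (0, x) = u₀ x) {t : ℝ} (ht0 : 0 ≤ t) (ht : t ∈ S) (x : ℝ) :
    u (t, x + (c₀ + (3 / 2) * u₀ x) * t) = u₀ x := by
  set c := c₀ + (3 / 2) * u₀ x with hc
  set D := S ×ˢ (univ : Set ℝ)
  let γ : ℝ → ℝ × ℝ := fun s => (s, x + c * s)
  have hγc : Continuous γ := by fun_prop
  have hγ : MapsTo γ S D := fun s hs => ⟨hs, mem_univ _⟩
  have hderiv (s : ℝ) (hs : s ∈ S) : HasDerivWithinAt (fun s => u (γ s) - u₀ x)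
      (-(3 / 2) * fderivWithin ℝ u D (γ s) (0, 1) * (u (γ s) - u₀ x)) S s := by
    have hγ' : HasDerivWithinAt γ (1, c) S s := by
      simpa using ((hasDerivAt_id s).prodMk
        (((hasDerivAt_id s).const_mul c).const_add x)).hasDerivWithinAt
    have hfd := (hu.differentiableOn one_ne_zero (γ s) (hγ hs)).hasFDerivWithinAt
    refine ((hfd.comp_hasDerivWithinAt s hγ' hγ).sub_const (u₀ x)).congr_deriv ?_
    have hsplit : ((1, c) : ℝ × ℝ) = (1, 0) + c • (0, 1) := by simp
    rw [hsplit, map_add, map_smul, smul_eq_mul]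
    linear_combination heq (γ s) (hγ hs) +
      fderivWithin ℝ u D (γ s) (0, 1) * hc
  have hcont : ContinuousOn (fun s => fderivWithin ℝ u D (γ s) (0, 1)) (Icc 0 t) :=
    ((hu.continuousOn_fderivWithin hud le_rfl).comp hγc.continuousOn
      (hγ.mono_left (hS t ht))).clm_apply continuousOn_const
  obtain ⟨K, hK⟩ := isCompact_Icc.exists_bound_of_continuousOn hcont
  have hzero := eq_zero_of_abs_deriv_le_mul_abs_self_of_eq_zero_right (K := 3 / 2 * K)
    (fun s hs => ((hderiv s (hS t ht hs)).continuousWithinAt).mono (hS t ht))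
    (fun s hs => (hderiv s (hS t ht (Ico_subset_Icc_self hs))).mono_of_mem_nhdsWithin
      (Filter.mem_of_superset (Icc_mem_nhdsGE hs.2)
        ((Icc_subset_Icc_left hs.1).trans (hS t ht))))
    (by simp [γ, h0])
    (fun s hs => by
      rw [norm_mul, norm_mul]
      have := hK s (Ico_subset_Icc_self hs)
      gcongr
      norm_num)
    t (right_mem_Icc.2 ht0)
  exact sub_eq_zero.1 hzero

/-- A function which is constant along the characteristics solves the Burgers equation. -/
theorem burgers_of_constant_on_characteristic {u : ℝ × ℝ → ℝ} {t x : ℝ}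
    (hud : UniqueDiffWithinAt ℝ S t) (ht : t ∈ S)
    (hD : UniqueDiffWithinAt ℝ (S ×ˢ (univ : Set ℝ)) (t, x + (c₀ + (3 / 2) * u₀ x) * t))
    (hu : DifferentiableAt ℝ u (t, x + (c₀ + (3 / 2) * u₀ x) * t))
    (h : ∀ s ∈ S, u (s, x + (c₀ + (3 / 2) * u₀ x) * s) = u₀ x) :
    fderivWithin ℝ u (S ×ˢ univ) (t, x + (c₀ + (3 / 2) * u₀ x) * t) (1, 0)
      + (c₀ + (3 / 2) * u (t, x + (c₀ + (3 / 2) * u₀ x) * t))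
        * fderivWithin ℝ u (S ×ˢ univ) (t, x + (c₀ + (3 / 2) * u₀ x) * t) (0, 1) = 0 := by
  rw [h t ht, hu.fderivWithin hD]
  set c := c₀ + (3 / 2) * u₀ x
  have hγ : HasDerivAt (fun s => (s, x + c * s)) ((1, c) : ℝ × ℝ) t := by
    simpa using (hasDerivAt_id t).prodMk (((hasDerivAt_id t).const_mul c).const_add x)
  have h1 : HasDerivWithinAt (fun s => u (s, x + c * s)) (fderiv ℝ u (t, x + c * t) (1, c)) S t :=
    (hu.hasFDerivAt.comp_hasDerivAt t hγ).hasDerivWithinAt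
  have h2 : HasDerivWithinAt (fun s => u (s, x + c * s)) 0 S t :=
    (hasDerivWithinAt_const t S (u₀ x)).congr h (h t ht)
  have h3 := hud.eq_deriv S h1 h2
  have hsplit : ((1, c) : ℝ × ℝ) = (1, 0) + c • (0, 1) := by simp
  rwa [hsplit, map_add, map_smul, smul_eq_mul] at h3

end Burgers

/-- Method of characteristics for the inviscid Burgers equation
`∂ₜu + (c₀ + (3/2)u)∂ₓu = 0` with bounded `C¹` data `u₀` with bounded
derivative: on the time interval `S = [0, T*)` (with `T* = −2/(3q)` if
`q = inf u₀' < 0`, `T* = ∞` otherwise), the characteristic maps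
`Φₜ : x₀ ↦ x₀ + (c₀ + (3/2)u₀(x₀))t` are `C¹` increasing bijections, there
exists a `C¹` solution with `u(0,·) = u₀` characterized by
`u(t, Φₜ(x₀)) = u₀(x₀)`, and it is unique on `S × ℝ`. -/
theorem stmt_13 (c₀ : ℝ) (u₀ : ℝ → ℝ) (hu₀ : ContDiff ℝ 1 u₀)
    (hbd : ∃ M : ℝ, ∀ x, |u₀ x| ≤ M) (hbd' : ∃ M : ℝ, ∀ x, |deriv u₀ x| ≤ M)
    (q : ℝ) (hq : IsGLB (Set.range (deriv u₀)) q)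
    (S : Set ℝ) (hS : S = {t : ℝ | 0 ≤ t ∧ (q < 0 → t < -2 / (3 * q))})
    (D : Set (ℝ × ℝ)) (hD : D = S ×ˢ (Set.univ : Set ℝ))
    (Φ : ℝ → ℝ → ℝ)
    (hΦ : ∀ t x₀, Φ t x₀ = x₀ + (c₀ + (3 / 2) * u₀ x₀) * t) :
    (∀ t ∈ S, ContDiff ℝ 1 (Φ t) ∧ StrictMono (Φ t) ∧ Function.Bijective (Φ t)) ∧
    (∃ u : ℝ × ℝ → ℝ, ContDiffOn ℝ 1 u D ∧
      (∀ p ∈ D,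
        fderivWithin ℝ u D p (1, 0)
          + (c₀ + (3 / 2) * u p) * fderivWithin ℝ u D p (0, 1) = 0) ∧
      (∀ x : ℝ, u (0, x) = u₀ x) ∧
      (∀ x₀ : ℝ, ∀ t ∈ S, u (t, Φ t x₀) = u₀ x₀)) ∧
    (∀ u v : ℝ × ℝ → ℝ,
      (ContDiffOn ℝ 1 u D ∧
        (∀ p ∈ D,
          fderivWithin ℝ u D p (1, 0)
            + (c₀ + (3 / 2) * u p) * fderivWithin ℝ u D p (0, 1) = 0) ∧
        (∀ x : ℝ, u (0, x) = u₀ x)) →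
      (ContDiffOn ℝ 1 v D ∧
        (∀ p ∈ D,
          fderivWithin ℝ v D p (1, 0)
            + (c₀ + (3 / 2) * v p) * fderivWithin ℝ v D p (0, 1) = 0) ∧
        (∀ x : ℝ, v (0, x) = u₀ x)) →
      Set.EqOn u v D) := by
  subst hD
  obtain ⟨M, hM⟩ := hbd
  obtain ⟨N, hN⟩ := hbd'
  have hq' (x : ℝ) : q ≤ deriv u₀ x := hq.1 (mem_range_self x)
  have hN0 : 0 ≤ N := (abs_nonneg _).trans (hN 0)
  let a : ℝ → ℝ := fun x => c₀ + (3 / 2) * u₀ x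
  have ha : ContDiff ℝ 1 a := by fun_prop
  have ha' (x : ℝ) : deriv a x = 3 / 2 * deriv u₀ x := by
    simp only [a, deriv_const_add]
    exact deriv_const_mul _ (hu₀.differentiable one_ne_zero x)
  have haM (x : ℝ) : |a x| ≤ |c₀| + 3 / 2 * M := by
    refine (abs_add_le _ _).trans ?_
    rw [abs_mul, abs_of_pos (by norm_num : (0 : ℝ) < 3 / 2)]
    linarith [hM x]
  let I : Set ℝ := {t | -(1 / (3 / 2 * (N + 1))) < t ∧ (q < 0 → t < -2 / (3 * q))}
  have hI : IsOpen I := by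
    by_cases h : q < 0
    · simp only [I, h, forall_const]
      exact isOpen_Ioo
    · simp only [I, h, false_imp_iff, and_true]
      exact isOpen_Ioi
  have hSI : S ⊆ I := by
    rw [hS]
    rintro t ⟨ht, htq⟩
    refine ⟨lt_of_lt_of_le (neg_neg_of_pos (by positivity)) ht, htq⟩
  have hpos (t : ℝ) (ht : t ∈ I) (x : ℝ) : 0 < 1 + deriv a x * t := by
    rw [ha' x]
    obtain ⟨htl, htr⟩ := ht
    rcases le_or_gt 0 t with h0 | h0
    · have hle := mul_le_mul_of_nonneg_right (hq' x) h0
      rcases lt_or_ge q 0 with hq0 | hq0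
      · have := (lt_div_iff_of_neg (by linarith)).1 (htr hq0)
        linarith
      · linarith [mul_nonneg hq0 h0]
    · have hle := mul_le_mul_of_nonpos_right (abs_le.1 (hN x)).2 h0.le
      have hlt : -1 < t * (3 / 2 * (N + 1)) := by
        rwa [← div_lt_iff₀ (by positivity), neg_div]
      linarith
  have hΦa (t : ℝ) : Φ t = fun y => y + a y * t := funext (hΦ t)
  have hmono (t : ℝ) (ht : t ∈ I) : StrictMono (Φ t) := by
    rw [hΦa]
    exact strictMono_characteristic ha (hpos t ht)
  have hsurj (t : ℝ) : Function.Surjective (Φ t) := by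
    rw [hΦa]
    exact surjective_characteristic ha.continuous haM t
  have h0S : (0 : ℝ) ∈ S := by
    rw [hS]
    exact ⟨le_rfl, fun h => div_pos_of_neg_of_neg (by norm_num) (by linarith)⟩
  have hnonneg (t : ℝ) (ht : t ∈ S) : 0 ≤ t := by
    rw [hS] at ht
    exact ht.1
  have hsub (t : ℝ) (ht : t ∈ S) : Icc 0 t ⊆ S := by
    rw [hS] at ht ⊢
    exact fun s hs => ⟨hs.1, fun h => hs.2.trans_lt (ht.2 h)⟩
  have hudS : UniqueDiffOn ℝ S := by
    rw [hS]
    by_cases h : q < 0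
    · simp only [h, forall_const]
      exact uniqueDiffOn_Ico (0 : ℝ) (-2 / (3 * q))
    · simp only [h, false_imp_iff, and_true]
      exact uniqueDiffOn_Ici (0 : ℝ)
  have hud : UniqueDiffOn ℝ (S ×ˢ (univ : Set ℝ)) := hudS.prod uniqueDiffOn_univ
  refine ⟨fun t ht => ⟨?_, hmono t (hSI ht), (hmono t (hSI ht)).injective, hsurj t⟩, ?_, ?_⟩
  · rw [hΦa]
    fun_prop
  · let X : ℝ × ℝ → ℝ := fun p => Function.surjInv (hsurj p.1) p.2
    have hX (t : ℝ) (ht : t ∈ I) (x : ℝ) : X (t, x + a x * t) = x := by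
      rw [← hΦ t x]
      exact Function.leftInverse_surjInv ⟨(hmono t ht).injective, hsurj t⟩ x
    have hchar (x t : ℝ) (ht : t ∈ S) : u₀ (X (t, x + a x * t)) = u₀ x := by
      rw [hX t (hSI ht)]
    have hCD (t : ℝ) (ht : t ∈ S) (x : ℝ) :
        ContDiffAt ℝ 1 (fun p => u₀ (X p)) (t, x + a x * t) :=
      hu₀.contDiffAt.comp _ (contDiffAt_inverse_characteristic ha hI hpos hX (hSI ht) x)
    refine ⟨fun p => u₀ (X p), ?_, ?_, fun x => ?_, fun x t ht => ?_⟩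
    · rintro ⟨t, y⟩ ⟨ht, -⟩
      obtain ⟨x, rfl⟩ := hsurj t y
      rw [hΦ t x]
      exact (hCD t ht x).contDiffWithinAt
    · rintro ⟨t, y⟩ ⟨ht, -⟩
      obtain ⟨x, rfl⟩ := hsurj t y
      rw [hΦ t x]
      exact burgers_of_constant_on_characteristic (hudS t ht) ht (hud _ ⟨ht, mem_univ _⟩)
        ((hCD t ht x).differentiableAt one_ne_zero) (hchar x)
    · simpa using hchar x 0 h0S
    · rw [hΦ t x]
      exact hchar x t ht
  · rintro u v ⟨hu, hu', hu0⟩ ⟨hv, hv', hv0⟩ ⟨t, y⟩ ⟨ht, -⟩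
    obtain ⟨x, rfl⟩ := hsurj t y
    rw [hΦ t x, eq_initial_of_burgers hsub hud hu hu' hu0 (hnonneg t ht) ht x,
      eq_initial_of_burgers hsub hud hv hv' hv0 (hnonneg t ht) ht x]
end

section
/- Let c₀ ∈ ℝ and let u₀ : ℝ → ℝ be a bounded C¹ function with bounded derivative and q := inf_ℝ u₀' < 0; set T* := −2/(3q). Let u : [0,T*) × ℝ → ℝ be the C¹ solution of the inviscid Burgers equation ∂_t u + (c₀ + (3/2)u) ∂_x u = 0 with u(0,·) = u₀ given by u(t, x₀ + (c₀ + (3/2)u₀(x₀))t) = u₀(x₀). Then for every t ∈ [0,T*), inf_{x ∈ ℝ} ∂_x u(t,x) = q / (1 + (3/2) q t); in particular u remains bounded while inf_{x} ∂_x u(t,·) → −∞ as t ↗ T* (wavebreaking). -/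
open Filter in
/-- A continuous bounded perturbation of the identity of `ℝ` is surjective. -/
lemma surjective_id_add_of_bounded {g : ℝ → ℝ} (hg : Continuous g) {K : ℝ}
    (hK : ∀ x, |g x| ≤ K) : Function.Surjective (fun x => x + g x) := by
  refine (continuous_id.add hg).surjective ?_ ?_
  · exact tendsto_atTop_add_right_of_le _ (-K) tendsto_id fun x => (abs_le.mp (hK x)).1
  · exact tendsto_atBot_add_right_of_ge _ K tendsto_id fun x => (abs_le.mp (hK x)).2

/-- The increasing map `s ↦ s / (1 + a s)` preserves greatest lower bounds where its
denominator is positive. -/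
lemma IsGLB.image_div_one_add_mul {S : Set ℝ} {q a : ℝ} (hq : IsGLB S q) (hS : S.Nonempty)
    (ha : 0 ≤ a) (hpos : 0 < 1 + a * q) :
    IsGLB ((fun s => s / (1 + a * s)) '' S) (q / (1 + a * q)) := by
  have hden : ∀ s ∈ S, 0 < 1 + a * s := fun s hs => by
    have := mul_le_mul_of_nonneg_left (hq.1 hs) ha
    linarith
  constructor
  · rintro _ ⟨s, hs, rfl⟩
    have := hq.1 hs
    rw [div_le_div_iff₀ hpos (hden s hs)]
    linarith
  · intro b hb
    have hb' : ∀ s ∈ S, b ≤ s * (1 - a * b) := fun s hs => by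
      have := (le_div_iff₀ (hden s hs)).mp (hb ⟨s, hs, rfl⟩)
      linarith
    obtain ⟨s, hs⟩ := hS
    have hab : 0 < 1 - a * b := by
      have h1 := mul_le_mul_of_nonneg_left (hb' s hs) ha
      by_contra! h
      nlinarith [mul_nonneg (hden s hs).le (neg_nonneg.mpr h), hden s hs]
    have : b / (1 - a * b) ≤ q := hq.2 fun r hr => (div_le_iff₀ hab).mpr (hb' r hr)
    rw [div_le_iff₀ hab] at this
    rw [le_div_iff₀ hpos]
    linarith


/-- Wavebreaking quantified: for the characteristic solution of the inviscid
Burgers equation with `q = inf u₀' < 0` and `T* = −2/(3q)`, one has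
`inf_x ∂ₓu(t,x) = q/(1 + (3/2)qt)` for every `t ∈ [0, T*)`. -/
theorem stmt_14 (c₀ : ℝ) (u₀ : ℝ → ℝ) (hu₀ : ContDiff ℝ 1 u₀)
    (hbd : ∃ M : ℝ, ∀ x, |u₀ x| ≤ M) (hbd' : ∃ M : ℝ, ∀ x, |deriv u₀ x| ≤ M)
    (q : ℝ) (hq : IsGLB (Set.range (deriv u₀)) q) (hqneg : q < 0)
    (T : ℝ) (hT : T = -2 / (3 * q))
    (D : Set (ℝ × ℝ)) (hD : D = Set.Ico (0 : ℝ) T ×ˢ (Set.univ : Set ℝ))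
    (u : ℝ × ℝ → ℝ) (hu : ContDiffOn ℝ 1 u D)
    (heq : ∀ p ∈ D,
      fderivWithin ℝ u D p (1, 0)
        + (c₀ + (3 / 2) * u p) * fderivWithin ℝ u D p (0, 1) = 0)
    (hinit : ∀ x : ℝ, u (0, x) = u₀ x)
    (hchar : ∀ x₀ : ℝ, ∀ t ∈ Set.Ico (0 : ℝ) T,
      u (t, x₀ + (c₀ + (3 / 2) * u₀ x₀) * t) = u₀ x₀) :
    ∀ t ∈ Set.Ico (0 : ℝ) T,
      IsGLB (Set.range (fun x => deriv (fun y => u (t, y)) x))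
        (q / (1 + (3 / 2) * q * t)) := by
  rintro t ⟨ht0, htT⟩
  have hpos : 0 < 1 + 3 / 2 * t * q := by
    rw [hT, lt_div_iff_of_neg (by linarith)] at htT
    linarith
  have ha : 0 ≤ 3 / 2 * t := by positivity
  have hdiff : Differentiable ℝ fun y => u (t, y) := by
    rw [← differentiableOn_univ]
    refine (hu.differentiableOn one_ne_zero).comp (f := fun y : ℝ => (t, y)) (by fun_prop) ?_
    intro y _
    rw [hD]
    exact ⟨⟨ht0, htT⟩, Set.mem_univ y⟩
  have hsurj : Function.Surjective fun x => x + (c₀ + 3 / 2 * u₀ x) * t := by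
    obtain ⟨M, hM⟩ := hbd
    have hcont : Continuous u₀ := hu₀.continuous
    refine surjective_id_add_of_bounded (g := fun x => (c₀ + 3 / 2 * u₀ x) * t)
      (K := (|c₀| + 3 / 2 * M) * t) (by fun_prop) fun x => ?_
    rw [abs_mul, abs_of_nonneg ht0]
    gcongr
    refine (abs_add_le _ _).trans ?_
    rw [abs_mul, abs_of_nonneg (by norm_num : (0 : ℝ) ≤ 3 / 2)]
    gcongr
    exact hM x
  have hderiv : ∀ x, deriv (fun y => u (t, y)) (x + (c₀ + 3 / 2 * u₀ x) * t)
      = deriv u₀ x / (1 + 3 / 2 * t * deriv u₀ x) := fun x => by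
    have hux : HasDerivAt u₀ (deriv u₀ x) x :=
      (hu₀.differentiable one_ne_zero x).hasDerivAt
    have hΦ : HasDerivAt (fun x => x + (c₀ + 3 / 2 * u₀ x) * t)
        (1 + 3 / 2 * deriv u₀ x * t) x :=
      (hasDerivAt_id x).add (((hux.const_mul _).const_add c₀).mul_const t)
    have hcomp := (hdiff (x + (c₀ + 3 / 2 * u₀ x) * t)).hasDerivAt.comp x hΦ
    have heq' : (fun y => u (t, y)) ∘ (fun x => x + (c₀ + 3 / 2 * u₀ x) * t) = u₀ :=
      funext fun x => hchar x t ⟨ht0, htT⟩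
    rw [heq'] at hcomp
    have hne : 1 + 3 / 2 * t * deriv u₀ x ≠ 0 := by
      have := mul_le_mul_of_nonneg_left (hq.1 ⟨x, rfl⟩) ha
      exact (hpos.trans_le (by linarith)).ne'
    rw [eq_div_iff hne]
    linarith [hux.unique hcomp]
  have hrange : Set.range (fun x => deriv (fun y => u (t, y)) x)
      = (fun s => s / (1 + 3 / 2 * t * s)) '' Set.range (deriv u₀) := by
    rw [← hsurj.range_comp, ← Set.range_comp]
    exact congrArg Set.range (funext hderiv)
  rw [hrange, mul_right_comm]
  exact hq.image_div_one_add_mul (Set.range_nonempty _) ha hpos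
end
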